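/- Let B be a Noetherian local ring which satisfies (S_n) (as a module over itself), and let M be a finite B-module satisfying both (S_n) and (S'_1). Then M satisfies (S'_n). -/

import Mathlib

open CategoryTheory

/-- Depth via local cohomology at the maximal ideal (following the paper). -/
noncomputable def localDepth (A : Type) [CommRing A] [IsLocalRing A]
    (M : Type) [AddCommGroup M] [Module A M] : ℕ∞ :=
  sInf {n : ℕ∞ | ∃ m : ℕ, n = (m : ℕ∞) ∧
    Nontrivial ((localCohomology (IsLocalRing.maximalIdeal A) m).obj (ModuleCat.of A M))}

/-- `depth_{A_P} M_P` for a prime `P`. -/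
noncomputable def primeLocalDepth (A : Type) [CommRing A] (P : Ideal A)
    (hP : P.IsPrime) (M : Type) [AddCommGroup M] [Module A M] : ℕ∞ :=
  haveI := hP
  localDepth (Localization.AtPrime P) (LocalizedModule P.primeCompl M)

/-- `dim A_P`, the height of the prime `P`. -/
noncomputable def primeKrullDim (A : Type) [CommRing A] (P : Ideal A)
    (hP : P.IsPrime) : WithBot ℕ∞ :=
  haveI := hP
  ringKrullDim (Localization.AtPrime P)

/-- `dim M_P`, the dimension of the localized module. -/
noncomputable def primeModuleDim (A : Type) [CommRing A] (P : Ideal A)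
    (hP : P.IsPrime) (M : Type) [AddCommGroup M] [Module A M] : WithBot ℕ∞ :=
  haveI := hP
  Order.krullDim
    (Module.support (Localization.AtPrime P) (LocalizedModule P.primeCompl M))

/-- Serre's condition `(S_n)`: `depth M_P ≥ min (n, dim M_P)` for all primes `P`. -/
def SerreS (A : Type) [CommRing A] (M : Type) [AddCommGroup M] [Module A M]
    (n : ℕ) : Prop :=
  ∀ (P : Ideal A) (hP : P.IsPrime),
    min (n : WithBot ℕ∞) (primeModuleDim A P hP M) ≤
      (primeLocalDepth A P hP M : WithBot ℕ∞)

/-- Serre's condition `(S'_n)`: `depth M_P ≥ min (n, dim A_P)` for all primes `P`. -/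
def SerreS' (A : Type) [CommRing A] (M : Type) [AddCommGroup M] [Module A M]
    (n : ℕ) : Prop :=
  ∀ (P : Ideal A) (hP : P.IsPrime),
    min (n : WithBot ℕ∞) (primeKrullDim A P hP) ≤
      (primeLocalDepth A P hP M : WithBot ℕ∞)

namespace CategoryTheory.ProjectiveResolution

open Limits Opposite

universe v u

section LeftDerived

variable {C : Type u} [Category.{v} C] {D : Type*} [Category* D]
  [Abelian C] [HasProjectiveResolutions C] [Abelian D] {X X' : C}

/-- A projective resolution `P` computes `F.leftDerived n` as a subobject of the opcycles of
`F(P)`. -/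
noncomputable def leftDerivedToOpcycles (P : ProjectiveResolution X) (F : C ⥤ D) [F.Additive]
    (n : ℕ) : (F.leftDerived n).obj X ⟶ ((F.mapHomologicalComplex _).obj P.complex).opcycles n :=
  (P.isoLeftDerivedObj F n).hom ≫ HomologicalComplex.homologyι _ n

instance (P : ProjectiveResolution X) (F : C ⥤ D) [F.Additive] (n : ℕ) :
    Mono (P.leftDerivedToOpcycles F n) :=
  mono_comp' inferInstance
    (inferInstanceAs (Mono (((F.mapHomologicalComplex _).obj P.complex).homologyι n)))

lemma leftDerivedToOpcycles_naturality (P : ProjectiveResolution X) (P' : ProjectiveResolution X')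
    (F : C ⥤ D) [F.Additive] (n : ℕ) (ψ : P.complex ⟶ P'.complex) (φ : X ⟶ X')
    (comm : ψ.f 0 ≫ P'.π.f 0 = P.π.f 0 ≫ φ) :
    P.leftDerivedToOpcycles F n ≫
      HomologicalComplex.opcyclesMap ((F.mapHomologicalComplex _).map ψ) n =
    (F.leftDerived n).map φ ≫ P'.leftDerivedToOpcycles F n := by
  have h2 := HomologicalComplex.homologyι_naturality ((F.mapHomologicalComplex _).map ψ) n
  have h1 := isoLeftDerivedObj_hom_naturality φ P P' ψ comm F n
  refine (Category.assoc _ _ _).trans ((congrArg _ h2.symm).trans ?_)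
  exact (Category.assoc _ _ _).symm.trans ((congrArg (· ≫ _) h1.symm).trans (Category.assoc _ _ _))

lemma leftDerivedToOpcycles_comp_fromOpcycles (P : ProjectiveResolution X)
    (F : C ⥤ D) [F.Additive] (n m : ℕ) :
    P.leftDerivedToOpcycles F n ≫ HomologicalComplex.fromOpcycles _ n m = 0 := by
  unfold leftDerivedToOpcycles
  erw [Category.assoc, HomologicalComplex.homologyι_comp_fromOpcycles, comp_zero]

lemma leftDerivedToOpcycles_exact (P : ProjectiveResolution X)
    (F : C ⥤ D) [F.Additive] (n m : ℕ) (hm : (ComplexShape.down ℕ).next n = m) :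
    (ShortComplex.mk _ _ (P.leftDerivedToOpcycles_comp_fromOpcycles F n m)).Exact := by
  have h0 := ShortComplex.exact_of_f_is_kernel (ShortComplex.mk _ _
    (((F.mapHomologicalComplex _).obj P.complex).homologyι_comp_fromOpcycles n m))
    (HomologicalComplex.homologyIsKernel _ n m hm)
  refine (ShortComplex.exact_iff_of_iso (ShortComplex.isoMk
    (S₁ := ShortComplex.mk _ _ (P.leftDerivedToOpcycles_comp_fromOpcycles F n m))
    (S₂ := ShortComplex.mk _ _
      (((F.mapHomologicalComplex _).obj P.complex).homologyι_comp_fromOpcycles n m))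
    (P.isoLeftDerivedObj F n) (Iso.refl _) (Iso.refl _) ?_ ?_)).mpr h0
  · exact (Category.comp_id _).symm
  · simp

end LeftDerived

variable {R : Type u} [CommRing R] {X X' : ModuleCat.{u} R}

/-- The complex `Hom(P, Y)`, viewed as a chain complex in the opposite category. -/
noncomputable abbrev opComplex (P : ProjectiveResolution X) (Y : ModuleCat.{u} R) :=
  (((linearYoneda R (ModuleCat.{u} R)).obj Y).rightOp.mapHomologicalComplex
    (ComplexShape.down ℕ)).obj P.complex

/-- The opposite of the projection from the cocycles of `Hom(P, Y)` to `Ext`. -/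
noncomputable abbrev extToOpcycles (P : ProjectiveResolution X) (Y : ModuleCat.{u} R) (n : ℕ) :=
  P.leftDerivedToOpcycles ((linearYoneda R (ModuleCat.{u} R)).obj Y).rightOp n

/-- `f` is a cocycle representing the class `e` in `Ext`. -/
def Represents (P : ProjectiveResolution X) {Y : ModuleCat.{u} R} {n : ℕ}
    (f : P.complex.X n ⟶ Y) (e : ((Ext R (ModuleCat.{u} R) n).obj (op X)).obj Y) : Prop :=
  ∃ z : ((P.opComplex Y).opcycles n).unop,
    ((P.opComplex Y).pOpcycles n).unop z = f ∧ (P.extToOpcycles Y n).unop z = e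

lemma exists_represents (P : ProjectiveResolution X) {Y : ModuleCat.{u} R} {n : ℕ}
    (e : ((Ext R (ModuleCat.{u} R) n).obj (op X)).obj Y) :
    ∃ f : P.complex.X n ⟶ Y, P.complex.d (n + 1) n ≫ f = 0 ∧ P.Represents f e := by
  obtain ⟨z, hz⟩ := (ModuleCat.epi_iff_surjective (P.extToOpcycles Y n).unop).mp inferInstance e
  refine ⟨((P.opComplex Y).pOpcycles n).unop z, ?_, z, rfl, hz⟩
  exact congr($(congrArg Quiver.Hom.unop ((P.opComplex Y).d_pOpcycles (n + 1) n)) z)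

lemma exists_represents_of_cocycle (P : ProjectiveResolution X) {Y : ModuleCat.{u} R} {n : ℕ}
    (f : P.complex.X n ⟶ Y) (hf : P.complex.d (n + 1) n ≫ f = 0) :
    ∃ e : ((Ext R (ModuleCat.{u} R) n).obj (op X)).obj Y, P.Represents f e := by
  have hex := (ShortComplex.exact_of_g_is_cokernel (ShortComplex.mk _ _
    ((P.opComplex Y).d_pOpcycles (n + 1) n))
    ((P.opComplex Y).opcyclesIsCokernel (n + 1) n (by simp))).unop
  rw [ShortComplex.moduleCat_exact_iff] at hex
  obtain ⟨z, hz⟩ := hex f hf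
  exact ⟨_, z, hz, rfl⟩

lemma Represents.eq_zero_iff {P : ProjectiveResolution X} {Y : ModuleCat.{u} R} {n : ℕ}
    {f : P.complex.X n ⟶ Y} {e : ((Ext R (ModuleCat.{u} R) n).obj (op X)).obj Y}
    (h : P.Represents f e) :
    e = 0 ↔ ∃ (m : ℕ) (g : P.complex.X m ⟶ Y), P.complex.d n m ≫ g = f := by
  obtain ⟨z, rfl, rfl⟩ := h
  have hw (m : ℕ) := P.leftDerivedToOpcycles_comp_fromOpcycles
    ((linearYoneda R (ModuleCat.{u} R)).obj Y).rightOp n m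
  have hinj : Function.Injective ((P.opComplex Y).pOpcycles n).unop :=
    (ModuleCat.mono_iff_injective _).mp inferInstance
  have hp (m : ℕ) (g : P.complex.X m ⟶ Y) : ((P.opComplex Y).pOpcycles n).unop
      (((P.opComplex Y).fromOpcycles n m).unop g) = P.complex.d n m ≫ g :=
    congr($(congrArg Quiver.Hom.unop ((P.opComplex Y).p_fromOpcycles n m)) g)
  constructor
  · intro h
    obtain ⟨m, hm⟩ : ∃ m, (ComplexShape.down ℕ).next n = m := ⟨_, rfl⟩
    have hex := (P.leftDerivedToOpcycles_exact
      ((linearYoneda R (ModuleCat.{u} R)).obj Y).rightOp n m hm).unop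
    rw [ShortComplex.moduleCat_exact_iff] at hex
    obtain ⟨g, hg⟩ := hex z h
    exact ⟨m, g, (hp m g).symm.trans congr(((P.opComplex Y).pOpcycles n).unop $hg)⟩
  · rintro ⟨m, g, hg⟩
    rw [← hp] at hg
    rw [← hinj hg]
    exact congr($(congrArg Quiver.Hom.unop (hw m)) g)

lemma Represents.map {P : ProjectiveResolution X} {P' : ProjectiveResolution X'}
    {Y : ModuleCat.{u} R} {n : ℕ}
    {f : P'.complex.X n ⟶ Y} {e : ((Ext R (ModuleCat.{u} R) n).obj (op X')).obj Y}
    (h : P'.Represents f e) (ψ : P.complex ⟶ P'.complex) (φ : X ⟶ X')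
    (comm : ψ ≫ P'.π = P.π ≫ (ChainComplex.single₀ _).map φ) :
    P.Represents (ψ.f n ≫ f) (((Ext R (ModuleCat.{u} R) n).map φ.op).app Y e) := by
  obtain ⟨z, rfl, rfl⟩ := h
  have comm' : ψ.f 0 ≫ P'.π.f 0 = P.π.f 0 ≫ φ := by
    rw [← HomologicalComplex.comp_f, comm, HomologicalComplex.comp_f,
      ChainComplex.single₀_map_f_zero]
    rfl
  let F := ((linearYoneda R (ModuleCat.{u} R)).obj Y).rightOp
  refine ⟨(HomologicalComplex.opcyclesMap ((F.mapHomologicalComplex _).map ψ) n).unop z, ?_, ?_⟩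
  · exact congr($(congrArg Quiver.Hom.unop
      (HomologicalComplex.p_opcyclesMap ((F.mapHomologicalComplex _).map ψ) n)) z)
  · exact congr($(congrArg Quiver.Hom.unop
      (leftDerivedToOpcycles_naturality P P' F n ψ φ comm')) z)

end CategoryTheory.ProjectiveResolution

namespace localCohomology

open Limits Opposite

variable {R : Type} [CommRing R]

/-- The projection `R ⧸ J ^ l ⟶ R ⧸ J ^ k` for `k ≤ l`. -/
noncomputable abbrev powQuotientMap (J : Ideal R) {k l : ℕ} (h : k ≤ l) :
    ModuleCat.of R (R ⧸ J ^ l) ⟶ ModuleCat.of R (R ⧸ J ^ k) :=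
  (ringModIdeals (idealPowersDiagram J)).map (homOfLE h).op

lemma powQuotientMap_comp (J : Ideal R) {k l m : ℕ} (h : k ≤ l) (h' : l ≤ m) :
    powQuotientMap J h' ≫ powQuotientMap J h = powQuotientMap J (h.trans h') :=
  ((ringModIdeals (idealPowersDiagram J)).map_comp _ _).symm

lemma subsingleton_iff_ext (J : Ideal R) (n : ℕ) (M : ModuleCat.{0} R) :
    Subsingleton ((localCohomology J n).obj M) ↔
    ∀ (k : ℕ) (e : ((Ext R (ModuleCat.{0} R) n).obj (op (ModuleCat.of R (R ⧸ J ^ k)))).obj M),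
      ∃ (l : ℕ) (h : k ≤ l),
        ((Ext R (ModuleCat.{0} R) n).map (powQuotientMap J h).op).app M e = 0 := by
  let D : ℕᵒᵖᵒᵖ ⥤ ModuleCat.{0} R ⥤ ModuleCat.{0} R := diagram (idealPowersDiagram J) n
  have : HasColimit D := hasColimitDiagram.{0, 0} (idealPowersDiagram J) n
  let c := ((evaluation _ _).obj M).mapCocone (colimit.cocone D)
  have hc : IsColimit c := isColimitOfPreserves _ (colimit.isColimit D)
  change Subsingleton c.pt ↔ _
  constructor
  · intro hs k e
    have h0 : c.ι.app (op (op k)) e = c.ι.app (op (op k)) 0 := hs.elim _ _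
    obtain ⟨l, f, g, hfg⟩ := (Concrete.isColimit_rep_eq_iff_exists _ hc _ _).mp h0
    refine ⟨l.unop.unop, f.unop.unop.down.down, ?_⟩
    rw [map_zero] at hfg
    exact hfg
  · intro H
    refine subsingleton_of_forall_eq 0 fun x ↦ ?_
    obtain ⟨k, e, rfl⟩ := Concrete.isColimit_exists_rep _ hc x
    obtain ⟨l, h, hl⟩ := H k.unop.unop e
    have h0 : c.ι.app k e = c.ι.app k 0 := by
      refine (Concrete.isColimit_rep_eq_iff_exists _ hc _ _).mpr
        ⟨op (op l), (homOfLE h).op.op, (homOfLE h).op.op, ?_⟩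
      rw [map_zero]
      exact hl
    exact h0.trans (map_zero _)

/-- Local cohomology vanishes iff every cocycle on a resolution of `R ⧸ J ^ k` becomes a coboundary
on some deeper resolution. -/
lemma subsingleton_iff_cocycle (J : Ideal R) (n : ℕ) (M : ModuleCat.{0} R)
    (P : ∀ k : ℕ, ProjectiveResolution (ModuleCat.of R (R ⧸ J ^ k))) :
    Subsingleton ((localCohomology J n).obj M) ↔
    ∀ (k : ℕ) (f : (P k).complex.X n ⟶ M), (P k).complex.d (n + 1) n ≫ f = 0 →
      ∃ (l : ℕ) (h : k ≤ l) (ψ : (P l).complex ⟶ (P k).complex) (m : ℕ)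
        (g : (P l).complex.X m ⟶ M),
        ψ ≫ (P k).π = (P l).π ≫ (ChainComplex.single₀ _).map (powQuotientMap J h) ∧
        (P l).complex.d n m ≫ g = ψ.f n ≫ f := by
  rw [subsingleton_iff_ext]
  constructor
  · intro H k f hf
    obtain ⟨e, he⟩ := (P k).exists_represents_of_cocycle f hf
    obtain ⟨l, h, hl⟩ := H k e
    have comm := ProjectiveResolution.lift_commutes (powQuotientMap J h) (P l) (P k)
    obtain ⟨m, g, hg⟩ := (he.map _ _ comm).eq_zero_iff.mp hl
    exact ⟨l, h, _, m, g, comm, hg⟩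
  · intro H k e
    obtain ⟨f, hf, he⟩ := (P k).exists_represents e
    obtain ⟨l, h, ψ, m, g, comm, hg⟩ := H k f hf
    exact ⟨l, h, (he.map ψ _ comm).eq_zero_iff.mpr ⟨m, g, hg⟩⟩

lemma subsingleton_of_subsingleton (J : Ideal R) (n : ℕ) (M : ModuleCat.{0} R) [Subsingleton M] :
    Subsingleton ((localCohomology J n).obj M) := by
  rw [subsingleton_iff_cocycle J n M fun _ ↦ projectiveResolution _]
  intro k f _
  exact ⟨k, le_rfl, ProjectiveResolution.lift (powQuotientMap J le_rfl) _ _, n, 0,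
    ProjectiveResolution.lift_commutes _ _ _, (ModuleCat.isZero_of_subsingleton M).eq_of_tgt _ _⟩

/-- A nonzero map `R ⧸ J → M` gives a nonzero class in `H⁰_J(M)`. -/
lemma subsingleton_linearMap_of_subsingleton (J : Ideal R) (M : ModuleCat.{0} R)
    (H : Subsingleton ((localCohomology J 0).obj M)) : Subsingleton ((R ⧸ J) →ₗ[R] M) := by
  let P : ∀ k : ℕ, ProjectiveResolution (ModuleCat.of R (R ⧸ J ^ k)) :=
    fun _ ↦ projectiveResolution _
  rw [subsingleton_iff_cocycle J 0 M P] at H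
  refine subsingleton_of_forall_eq 0 fun φ ↦ ?_
  let φ' : ModuleCat.of R (R ⧸ J ^ 1) ⟶ M :=
    ModuleCat.ofHom (φ ∘ₗ Submodule.mapQ (J ^ 1) J LinearMap.id (by simp))
  obtain ⟨l, h, ψ, m, g, comm, hg⟩ := H 1 ((P 1).π.f 0 ≫ φ') 
    ((Category.assoc _ _ _).symm.trans
      ((congrArg (· ≫ φ') (P 1).complex_d_comp_π_f_zero).trans zero_comp))
  rw [(P l).complex.shape 0 m (by simp), zero_comp] at hg
  have comm0 : ψ.f 0 ≫ (P 1).π.f 0 ≫ φ' = (P l).π.f 0 ≫ powQuotientMap J h ≫ φ' := by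
    have := congr($(HomologicalComplex.congr_hom comm 0) ≫ φ')
    exact (Category.assoc _ _ _).symm.trans (this.trans (Category.assoc _ _ _))
  have h1 : powQuotientMap J h ≫ φ' = 0 :=
    (cancel_epi ((P l).π.f 0)).mp (comm0.symm.trans (hg.symm.trans comp_zero.symm))
  ext
  exact congr($h1 (Ideal.Quotient.mk _ 1))

/-- A fragment of the long exact sequence for local cohomology. -/
lemma subsingleton_of_shortExact (J : Ideal R) (n : ℕ) {S : ShortComplex (ModuleCat.{0} R)}
    (hS : S.ShortExact) (H2 : Subsingleton ((localCohomology J n).obj S.X₂))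
    (H1 : Subsingleton ((localCohomology J (n + 1)).obj S.X₁)) :
    Subsingleton ((localCohomology J n).obj S.X₃) := by
  have := hS.epi_g
  have := hS.mono_f
  let P : ∀ k : ℕ, ProjectiveResolution (ModuleCat.of R (R ⧸ J ^ k)) :=
    fun _ ↦ projectiveResolution _
  rw [subsingleton_iff_cocycle J _ _ P] at H1 H2 ⊢
  intro k f hf
  let f' := Projective.factorThru f S.g
  have hf' : f' ≫ S.g = f := Projective.factorThru_comp f S.g
  let g := hS.exact.lift ((P k).complex.d (n + 1) n ≫ f') (by rw [Category.assoc, hf', hf])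
  have hg : g ≫ S.f = (P k).complex.d (n + 1) n ≫ f' := hS.exact.lift_f _ _
  obtain ⟨l, h, ψ, m, b, comm, hb⟩ := H1 k g (by
    rw [← cancel_mono S.f, Category.assoc, hg, HomologicalComplex.d_comp_d_assoc, zero_comp,
      zero_comp])
  obtain ⟨b, hb⟩ : ∃ b : (P l).complex.X n ⟶ S.X₁,
      (P l).complex.d (n + 1) n ≫ b = ψ.f (n + 1) ≫ g := by
    by_cases hm : m = n
    · subst hm
      exact ⟨b, hb⟩
    · rw [(P l).complex.shape (n + 1) m (by simpa using hm), zero_comp] at hb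
      exact ⟨0, by rw [comp_zero, hb]⟩
  obtain ⟨l', h', ψ', m', u, comm', hu⟩ := H2 l (ψ.f n ≫ f' - b ≫ S.f) (by
    rw [Preadditive.comp_sub, ← HomologicalComplex.Hom.comm_assoc, reassoc_of% hb, hg, sub_self])
  refine ⟨l', h.trans h', ψ' ≫ ψ, m', u ≫ S.g, ?_, ?_⟩
  · rw [Category.assoc, comm, reassoc_of% comm', ← Functor.map_comp, powQuotientMap_comp]
  · rw [reassoc_of% hu]
    simp [hf']

end localCohomology

open scoped Pointwise in
/-- If `x` is `M`-regular and lies in the Jacobson radical, any associated prime of `M` specializes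
to an associated prime of `M ⧸ xM` containing `x`. -/
lemma exists_isAssociatedPrime_quotSMulTop {R M : Type*} [CommRing R] [IsNoetherianRing R]
    [AddCommGroup M] [Module R M] [Module.Finite R M] {x : R} (hx : IsSMulRegular M x)
    (hxJ : x ∈ (⊥ : Ideal R).jacobson) {p : Ideal R} (hp : IsAssociatedPrime p M) :
    ∃ q : Ideal R, IsAssociatedPrime q (QuotSMulTop x M) ∧ p ≤ q ∧ x ∈ q := by
  obtain ⟨hp, y, hy⟩ := isAssociatedPrime_iff.mp hp
  have hy0 : y ≠ 0 := by
    rintro rfl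
    exact hp.ne_top (by simp [hy])
  let K : Submodule R M := Submodule.torsionBySet R M p
  have hyK : y ∈ K := by
    rw [Submodule.mem_torsionBySet_iff]
    rintro ⟨a, ha⟩
    simpa using Submodule.mem_colon_singleton.mp (hy.le ha)
  have hK : ¬ K ≤ x • ⊤ := fun hle ↦ by
    have hKK : K ≤ Ideal.span {x} • K := fun z hz ↦ by
      obtain ⟨w, -, rfl⟩ := hle hz
      rw [Submodule.mem_torsionBySet_iff] at hz
      refine Submodule.smul_mem_smul (Ideal.mem_span_singleton_self x) ?_
      rw [Submodule.mem_torsionBySet_iff]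
      refine fun a ↦ hx ?_
      simpa [smul_comm x] using hz a
    have := Submodule.eq_bot_of_le_smul_of_le_jacobson_bot _ K (IsNoetherian.noetherian K) hKK
      (by simpa [Ideal.span_le] using hxJ)
    exact hy0 (by simpa [this] using hyK)
  obtain ⟨z, hzK, hz⟩ := SetLike.not_le_iff_exists.mp hK
  obtain ⟨q, hq, hle⟩ := exists_le_isAssociatedPrime_of_isNoetherianRing R
    (Submodule.Quotient.mk z : QuotSMulTop x M) (by rwa [ne_eq, Submodule.Quotient.mk_eq_zero])
  refine ⟨q, hq, fun a ha ↦ hle ?_, hle ?_⟩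
  · rw [Submodule.mem_colon_singleton, ← Submodule.Quotient.mk_smul,
      (Submodule.mem_torsionBySet_iff _ _).mp hzK ⟨a, ha⟩]
    simp
  · rw [Submodule.mem_colon_singleton, ← Submodule.Quotient.mk_smul, Submodule.mem_bot,
      Submodule.Quotient.mk_eq_zero]
    exact Submodule.smul_mem_pointwise_smul _ _ _ trivial

/-- An associated prime consists of zero divisors. -/
lemma IsAssociatedPrime.notMem_of_isSMulRegular {R M : Type*} [CommRing R] [IsNoetherianRing R]
    [AddCommGroup M] [Module R M] {x : R} (hx : IsSMulRegular M x) {p : Ideal R}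
    (hp : IsAssociatedPrime p M) : x ∉ p := by
  obtain ⟨hp, y, hy⟩ := isAssociatedPrime_iff.mp hp
  intro hxp
  have hxy : x • y = 0 := by simpa using Submodule.mem_colon_singleton.mp (hy.le hxp)
  have hy0 : y = 0 := hx (by simpa using hxy)
  exact hp.ne_top (by simp [hy, hy0])

lemma ringKrullDim_quotient_add_one_le_of_lt {R : Type*} [CommRing R] {p q : Ideal R} [p.IsPrime]
    (h : p < q) : ringKrullDim (R ⧸ q) + 1 ≤ ringKrullDim (R ⧸ p) := by
  obtain ⟨x, hxq, hxp⟩ := SetLike.exists_of_lt h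
  refine ringKrullDim_succ_le_of_surjective (Ideal.Quotient.factor h.le)
    (Ideal.Quotient.factor_surjective h.le) (r := Ideal.Quotient.mk p x)
    (mem_nonZeroDivisors_of_ne_zero ?_) ?_
  · rwa [ne_eq, Ideal.Quotient.eq_zero_iff_mem]
  · rwa [Ideal.Quotient.factor_mk, Ideal.Quotient.eq_zero_iff_mem]

/-- The depth of a module is at most the dimension of the closure of any of its associated
points. -/
lemma localCohomology.natCast_le_ringKrullDim_quotient {A : Type} [CommRing A]
    [IsNoetherianRing A] [IsLocalRing A] (t : ℕ) {N : Type} [AddCommGroup N] [Module A N]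
    [Module.Finite A N]
    (H : ∀ i < t, Subsingleton
      ((localCohomology (IsLocalRing.maximalIdeal A) i).obj (ModuleCat.of A N)))
    {p : Ideal A} (hp : IsAssociatedPrime p N) : (t : WithBot ℕ∞) ≤ ringKrullDim (A ⧸ p) := by
  induction t generalizing N p with
  | zero =>
    have := Ideal.Quotient.nontrivial_iff.mpr hp.isPrime.ne_top
    exact_mod_cast ringKrullDim_nonneg_of_nontrivial
  | succ t ih =>
    have := hp.isPrime
    have h0 := subsingleton_linearMap_of_subsingleton _ _ (H 0 t.succ_pos)
    obtain ⟨x, hxm, hx⟩ := IsSMulRegular.subsingleton_linearMap_iff.mp h0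
    rw [Ideal.annihilator_quotient] at hxm
    obtain ⟨q, hq, hpq, hxq⟩ := exists_isAssociatedPrime_quotSMulTop hx
      (IsLocalRing.maximalIdeal_le_jacobson _ hxm) hp
    have hlt : p < q := lt_of_le_of_ne hpq fun h ↦ hp.notMem_of_isSMulRegular hx (h ▸ hxq)
    have ht := ih (N := QuotSMulTop x N) (fun i hi ↦ subsingleton_of_shortExact _ i
      (IsSMulRegular.smulShortComplex_shortExact (M := ModuleCat.of A N) hx)
      (H i (by omega)) (H (i + 1) (by omega))) hq
    push_cast
    exact (add_le_add_left ht 1).trans (ringKrullDim_quotient_add_one_le_of_lt hlt)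

section localDepth

variable {A : Type} [CommRing A] [IsLocalRing A] {N : Type} [AddCommGroup N] [Module A N]

lemma subsingleton_localCohomology_of_lt_localDepth {i : ℕ} (h : (i : ℕ∞) < localDepth A N) :
    Subsingleton ((localCohomology (IsLocalRing.maximalIdeal A) i).obj (ModuleCat.of A N)) := by
  by_contra hs
  rw [not_subsingleton_iff_nontrivial] at hs
  exact h.not_ge (sInf_le ⟨i, rfl, hs⟩)

lemma localDepth_eq_top_of_subsingleton [Subsingleton N] : localDepth A N = ⊤ := by
  rw [localDepth, sInf_eq_top]
  rintro _ ⟨m, -, hm⟩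
  have : Subsingleton (ModuleCat.of A N) := ‹Subsingleton N›
  exact absurd hm (not_nontrivial_iff_subsingleton.mpr
    (localCohomology.subsingleton_of_subsingleton _ _ _))

variable [IsNoetherianRing A] [Module.Finite A N]

lemma localDepth_le_ringKrullDim_quotient {p : Ideal A} (hp : IsAssociatedPrime p N) :
    (localDepth A N : WithBot ℕ∞) ≤ ringKrullDim (A ⧸ p) := by
  have := Ideal.Quotient.nontrivial_iff.mpr hp.isPrime.ne_top
  obtain ⟨d, hd⟩ := WithBot.ne_bot_iff_exists.mp
    ((WithBot.bot_lt_coe 0).trans_le (ringKrullDim_nonneg_of_nontrivial (R := A ⧸ p))).ne'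
  rw [← hd, WithBot.coe_le_coe, ← ENat.forall_natCast_le_iff_le]
  intro t ht
  rw [← WithBot.coe_le_coe, hd]
  exact localCohomology.natCast_le_ringKrullDim_quotient t (fun i hi ↦
      subsingleton_localCohomology_of_lt_localDepth ((Nat.cast_lt.mpr hi).trans_le ht)) hp

lemma localDepth_eq_zero_of_maximalIdeal_isAssociatedPrime
    (h : IsAssociatedPrime (IsLocalRing.maximalIdeal A) N) : localDepth A N = 0 := by
  have := localDepth_le_ringKrullDim_quotient h
  have h0 : ringKrullDim (A ⧸ IsLocalRing.maximalIdeal A) = 0 :=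
    ringKrullDim_eq_zero_of_isField ((Ideal.Quotient.maximal_ideal_iff_isField_quotient _).mp
      inferInstance)
  rw [h0] at this
  exact le_zero_iff.mp (by exact_mod_cast this)

end localDepth

lemma IsAssociatedPrime.ringKrullDim_quotient_le_supportDim {R M : Type*} [CommRing R]
    [AddCommGroup M] [Module R M] [Module.Finite R M] {p : Ideal R}
    (hp : IsAssociatedPrime p M) : ringKrullDim (R ⧸ p) ≤ Module.supportDim R M := by
  rw [Module.supportDim_eq_ringKrullDim_quotient_annihilator]
  have hle : Module.annihilator R M ≤ p := by
    simpa [Submodule.annihilator_top] using hp.annihilator_le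
  exact ringKrullDim_le_of_surjective (Ideal.Quotient.factor hle)
    (Ideal.Quotient.factor_surjective hle)

lemma isAssociatedPrime_self_of_mem_minimalPrimes {R : Type*} [CommRing R] [IsNoetherianRing R]
    {p : Ideal R} (hp : p ∈ minimalPrimes R) : IsAssociatedPrime p R := by
  refine Module.associatedPrimes.minimalPrimes_annihilator_subset_associatedPrimes R R ?_
  rwa [Module.annihilator_eq_bot.mpr inferInstance]

lemma primeModuleDim_self {A : Type} [CommRing A] (P : Ideal A) (hP : P.IsPrime) :
    primeModuleDim A P hP A = primeKrullDim A P hP := by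
  refine (Module.supportDim_eq_of_equiv ?_).trans (Module.supportDim_self_eq_ringKrullDim _)
  exact (IsLocalizedModule.iso P.primeCompl (Algebra.linearMap A (Localization.AtPrime P))
    ).extendScalarsOfIsLocalization P.primeCompl _

/-- Under `(S'₁)`, the associated primes of a module are minimal primes of the ring. -/
lemma mem_minimalPrimes_of_isAssociatedPrime {A : Type} [CommRing A] [IsNoetherianRing A]
    {M : Type} [AddCommGroup M] [Module A M] [Module.Finite A M] (hM : SerreS' A M 1)
    {p : Ideal A} (hp : IsAssociatedPrime p M) : p ∈ minimalPrimes A := by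
  have hp' := hp.isPrime
  have h := hM p hp'
  rw [primeLocalDepth, localDepth_eq_zero_of_maximalIdeal_isAssociatedPrime
    (Module.associatedPrimes.mem_associatedPrimes_atPrime_of_mem_associatedPrimes hp),
    primeKrullDim, IsLocalization.AtPrime.ringKrullDim_eq_height p] at h
  have h0 : min 1 p.height ≤ 0 := by exact_mod_cast h
  rw [← Ideal.height_eq_zero_iff]
  simpa using h0

/-- **Corollary.**
Let `B` be a Noetherian local ring which satisfies `(S_n)` (as a module over
itself), and let `M` be a finite `B`-module satisfying both `(S_n)` and `(S'_1)`.
Then `M` satisfies `(S'_n)`. -/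
theorem serreS'_of_serreS_and_serreS'_one
    (B : Type) [CommRing B] [IsNoetherianRing B] [IsLocalRing B]
    (M : Type) [AddCommGroup M] [Module B M] [Module.Finite B M]
    (n : ℕ) (hB : SerreS B B n) (hM : SerreS B M n) (hM1 : SerreS' B M 1) :
    SerreS' B M n := by
  intro P hP
  rw [primeLocalDepth]
  rcases subsingleton_or_nontrivial (LocalizedModule P.primeCompl M) with h | h
  · simp [localDepth_eq_top_of_subsingleton]
  have hPM : (⟨P, hP⟩ : PrimeSpectrum B) ∈ Module.support B M := Module.mem_support_iff.mpr h
  obtain ⟨Q, hQ, hQP⟩ :=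
    Ideal.exists_minimalPrimes_le (Module.annihilator_le_of_mem_support hPM)
  have hQ' := hQ.isPrime
  have hQM := Module.associatedPrimes.minimalPrimes_annihilator_subset_associatedPrimes B M hQ
  have hQB := isAssociatedPrime_self_of_mem_minimalPrimes
    (mem_minimalPrimes_of_isAssociatedPrime hM1 hQM)
  have hq {N : Type} [AddCommGroup N] [Module B N] (hN : IsAssociatedPrime Q N) :
      IsAssociatedPrime (Q.map (algebraMap B (Localization.AtPrime P)))
        (LocalizedModule P.primeCompl N) := by
    open Module.associatedPrimes in
    refine mem_associatedPrimes_of_comap_mem_associatedPrimes_of_isLocalizedModule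
      P.primeCompl (LocalizedModule.mkLinearMap P.primeCompl N) _ ?_
    refine (congrArg (IsAssociatedPrime · N) ?_).mpr hN
    exact IsLocalization.under_map_of_isPrime_disjoint P.primeCompl (Localization.AtPrime P) hQ'
      (Set.disjoint_left.mpr fun x (hx : x ∉ P) hxQ ↦ hx (hQP hxQ))
  have hdim : min (n : WithBot ℕ∞) (primeKrullDim B P hP) ≤ primeModuleDim B P hP M :=
    calc
      _ ≤ min (n : WithBot ℕ∞) (primeModuleDim B P hP B) :=
        min_le_min_left _ (primeModuleDim_self P hP).ge
      _ ≤ primeLocalDepth B P hP B := hB P hP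
      _ ≤ ringKrullDim (_ ⧸ Q.map (algebraMap B (Localization.AtPrime P))) :=
        localDepth_le_ringKrullDim_quotient (hq hQB)
      _ ≤ primeModuleDim B P hP M := (hq hQM).ringKrullDim_quotient_le_supportDim
  exact (le_min (min_le_left _ _) hdim).trans (hM P hP)
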